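/- arXiv:1010.2767 — 3 statements merged into one kernel-verified Lean document; each statement's English description precedes it below -/
import Mathlib

section
/- Let d, n, t be positive integers with n ≥ 2, and suppose d is smaller than the number of monomials in R_t (hence also in R_{t+1}). Then d_{n,t+1} ≤ d_{n,t}. -/
open scoped Classical
open Finset

noncomputable section

/-- The monomials of degree `t` in `n` variables, identified with exponent vectors. -/
def degMon (n t : ℕ) : Finset (Fin n → ℕ) := Finset.Nat.antidiagonalTuple n t

/-- The exponent of `x_1` in a monomial. -/
def x1exp {n : ℕ} (m : Fin n → ℕ) : ℕ := if h : 0 < n then m ⟨0, h⟩ else 0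

/-- `lexLt u v` : `u` is lexicographically smaller than `v` as monomials
(with `x_1 > x_2 > ... > x_n`), i.e. `v > u`. -/
def lexLt {n : ℕ} (u v : Fin n → ℕ) : Prop :=
  ∃ i : Fin n, (∀ j : Fin n, j < i → u j = v j) ∧ u i < v i

/-- `M` is a lexsegment set inside the ground set `G` of monomials. -/
def IsLexSeg {n : ℕ} (G M : Finset (Fin n → ℕ)) : Prop :=
  M ⊆ G ∧ ∀ m ∈ M, ∀ v ∈ G, lexLt m v → v ∈ M

/-- The lexsegment set consisting of the top `d` monomials of `G` in the lex order. -/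
def lexSeg {n : ℕ} (G : Finset (Fin n → ℕ)) (d : ℕ) : Finset (Fin n → ℕ) :=
  G.filter (fun m => (G.filter (fun v => m = v ∨ lexLt m v)).card ≤ d)

/-- `S_1 · M` : all monomials `u * m` with `u` a variable and `m ∈ M`. -/
def S1mul (n : ℕ) (M : Finset (Fin n → ℕ)) : Finset (Fin n → ℕ) :=
  Finset.univ.biUnion (fun i : Fin n => M.image (fun m => m + Pi.single i 1))

/-- `S'_1 · M` : all monomials `x_i * m` with `2 ≤ i ≤ n` and `m ∈ M`. -/
def S1'mul (n : ℕ) (M : Finset (Fin n → ℕ)) : Finset (Fin n → ℕ) :=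
  (Finset.univ.filter (fun i : Fin n => (i : ℕ) ≠ 0)).biUnion
    (fun i => M.image (fun m => m + Pi.single i 1))

/-- `d^{<k>}` : the number of monomials obtained by multiplying each member of the
lexsegment set of `d` monomials of a fixed degree in `k+1` variables by each of the
`k+1` variables.  (We realize it in degree `d`, where the lexsegment set exists;
the number is independent of the chosen degree.  Also `0^{<k>} = 0`.) -/
def growth (d k : ℕ) : ℕ := (S1mul (k + 1) (lexSeg (degMon (k + 1) d) d)).card

/-- The monomials of `R_t` where `R = S/(x_1^a)` : degree-`t` monomials whose
`x_1`-exponent is at most `a - 1`. -/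
def RMon (n a t : ℕ) : Finset (Fin n → ℕ) :=
  (degMon n t).filter (fun m => x1exp m < a)

/-- `R_1 · M` : the monomials of `S_1 · M` not divisible by `x_1^a`. -/
def R1mul (n a : ℕ) (M : Finset (Fin n → ℕ)) : Finset (Fin n → ℕ) :=
  (S1mul n M).filter (fun m => x1exp m < a)

/-- `d_{n,t}` : the size of `R_1 · L` for the lexsegment set `L` of `d` monomials in `R_t`. -/
def dnt (n a t d : ℕ) : ℕ := (R1mul n a (lexSeg (RMon n a t) d)).card

/-- `M^i` : the monomials of `M` divisible by `x_1^i` but not by `x_1^{i+1}`. -/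
def comp {n : ℕ} (M : Finset (Fin n → ℕ)) (i : ℕ) : Finset (Fin n → ℕ) :=
  M.filter (fun m => x1exp m = i)

/-- `I(M)` : the smallest `i` such that `M^i ≠ ∅`. -/
def Imon {n : ℕ} (M : Finset (Fin n → ℕ)) : ℕ := sInf {i | (comp M i).Nonempty}

/-- `M` is Gotzmann in `S_t`. -/
def GotzmannS (n t : ℕ) (M : Finset (Fin n → ℕ)) : Prop :=
  (S1mul n (lexSeg (degMon n t) M.card)).card = (S1mul n M).card

/-- `M` is Gotzmann in `R_t`, `R = S/(x_1^a)`. -/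
def GotzmannR (n a t : ℕ) (M : Finset (Fin n → ℕ)) : Prop :=
  (R1mul n a (lexSeg (RMon n a t) M.card)).card = (R1mul n a M).card

/-- The monomials of degree `t` of `S' = F[x_2,...,x_n]`, viewed inside the `n`
variables as the monomials with `x_1`-exponent `0`. -/
def SpMon (n t : ℕ) : Finset (Fin n → ℕ) :=
  (degMon n t).filter (fun m => x1exp m = 0)

/-- `M` is Gotzmann in `S' = F[x_2,...,x_n]` (in degree `t`). -/
def GotzmannSp (n t : ℕ) (M : Finset (Fin n → ℕ)) : Prop :=
  (S1'mul n (lexSeg (SpMon n t) M.card)).card = (S1'mul n M).card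

/-- Dividing a monomial by the pure power of `x_1` it contains: set the first exponent to `0`. -/
def clearX1 {n : ℕ} (m : Fin n → ℕ) : Fin n → ℕ :=
  fun j => if (j : ℕ) = 0 then 0 else m j

/-- `M^i / x_1` : the monomials `m` of `S'` with `m * x_1^i ∈ M^i` (applied to `M = M^i`). -/
def divX1 {n : ℕ} (M : Finset (Fin n → ℕ)) : Finset (Fin n → ℕ) :=
  M.image clearX1

/-- `u · M` : the monomials `u * m` with `m ∈ M`. -/
def mulMon {n : ℕ} (u : Fin n → ℕ) (M : Finset (Fin n → ℕ)) : Finset (Fin n → ℕ) :=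
  M.image (fun m => u + m)

/-- The set `B` of degree-`t` monomials of `S` divisible by `x_1^a`. -/
def Bset (n a t : ℕ) : Finset (Fin n → ℕ) :=
  (degMon n t).filter (fun m => a ≤ x1exp m)
def Dom (l l' : List ℕ) : Prop :=
  l.length = l'.length ∧ ∀ d, (l.take d).sum ≤ (l'.take d).sum

theorem Dom.refl (l : List ℕ) : Dom l l := ⟨rfl, fun _ => le_rfl⟩

theorem Dom.trans {a b c : List ℕ} (h : Dom a b) (h' : Dom b c) : Dom a c :=
  ⟨h.1.trans h'.1, fun d => (h.2 d).trans (h'.2 d)⟩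

theorem Dom.app {a a' b b' : List ℕ} (h : Dom a a') (h' : Dom b b') :
    Dom (a ++ b) (a' ++ b') := by
  refine ⟨by simp [h.1, h'.1], fun d => ?_⟩
  simp only [List.take_append, List.sum_append, h.1]
  exact Nat.add_le_add (h.2 d) (h'.2 _)

theorem Dom.front {M : ℕ} (P : List ℕ) (h : ∀ x ∈ P, x ≤ M) : Dom (P ++ [M]) ([M] ++ P) := by
  induction P with
  | nil => exact Dom.refl _
  | cons x P ih =>
    have h1 : Dom ([x] ++ (P ++ [M])) ([x] ++ ([M] ++ P)) :=
      (Dom.refl _).app (ih fun y hy => h y (by simp [hy]))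
    have h2 : Dom ([x, M] ++ P) ([M, x] ++ P) := by
      refine Dom.app ⟨rfl, fun d => ?_⟩ (Dom.refl _)
      have := h x (by simp)
      match d with
      | 0 => simp
      | 1 => simpa using this
      | d + 2 => simp [Nat.add_comm]
    exact h1.trans h2

theorem swap1 (f : ℕ → List ℕ) (hf : ∀ a b, a ≤ b → Dom (f b ++ f a) (f a ++ f b))
    (b : ℕ) (l : List ℕ) (h : ∀ a ∈ l, a ≤ b) :
    Dom (f b ++ l.flatMap f) (l.flatMap f ++ f b) := by
  induction l with
  | nil => simpa using Dom.refl _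
  | cons x l ih =>
    have h1 := (hf x b (h x (by simp))).app (Dom.refl (l.flatMap f))
    have h2 := (Dom.refl (f x)).app (ih fun a ha => h a (by simp [ha]))
    simp only [List.flatMap_cons, List.append_assoc] at *
    exact h1.trans h2

theorem swap2 (f : ℕ → List ℕ) (hf : ∀ a b, a ≤ b → Dom (f b ++ f a) (f a ++ f b))
    (l' l : List ℕ) (h : ∀ b ∈ l', ∀ a ∈ l, a ≤ b) :
    Dom (l'.flatMap f ++ l.flatMap f) (l.flatMap f ++ l'.flatMap f) := by
  induction l' with
  | nil => simpa using Dom.refl _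
  | cons x l' ih =>
    have h1 := (Dom.refl (f x)).app (ih fun b hb => h b (by simp [hb]))
    have h2 := (swap1 f hf x l (h x (by simp))).app (Dom.refl (l'.flatMap f))
    simp only [List.flatMap_cons, List.append_assoc] at *
    exact h1.trans h2

/-- swap property lifts -/
theorem swap_lift (f g : ℕ → List ℕ) (M : ℕ)
    (hf : ∀ a b, a ≤ b → Dom (f b ++ f a) (f a ++ f b)) (hM : ∀ j, ∀ x ∈ f j, x ≤ M)
    (hg : ∀ k, g k = [M] ++ (List.range' 1 k).flatMap f) (k c : ℕ) :
    Dom ((List.range' (k+1) c).flatMap f ++ g k) (g k ++ (List.range' (k+1) c).flatMap f) := by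
  have h1 : Dom ((List.range' (k+1) c).flatMap f ++ [M]) ([M] ++ (List.range' (k+1) c).flatMap f) :=
    Dom.front _ (by
      intro x hx
      obtain ⟨j, -, hj⟩ := List.mem_flatMap.1 hx
      exact hM j x hj)
  have h2 := swap2 f hf (List.range' (k+1) c) (List.range' 1 k) (by
    intro b hb a ha
    simp only [List.mem_range'_1] at *
    omega)
  have h1' := h1.app (Dom.refl ((List.range' 1 k).flatMap f))
  have h2' := (Dom.refl [M]).app h2
  rw [hg]
  simp only [List.append_assoc] at *
  exact h1'.trans h2'

theorem g_add (f g : ℕ → List ℕ) (M : ℕ)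
    (hg : ∀ k, g k = [M] ++ (List.range' 1 k).flatMap f) (k c : ℕ) :
    g (k + c) = g k ++ (List.range' (k+1) c).flatMap f := by
  rw [hg, hg, List.append_assoc, ← List.flatMap_append, Nat.add_comm k 1, List.range'_append_1]

theorem swap_next (f g : ℕ → List ℕ) (M : ℕ)
    (hf : ∀ a b, a ≤ b → Dom (f b ++ f a) (f a ++ f b)) (hM : ∀ j, ∀ x ∈ f j, x ≤ M)
    (hg : ∀ k, g k = [M] ++ (List.range' 1 k).flatMap f) (a b : ℕ) (hab : a ≤ b) :
    Dom (g b ++ g a) (g a ++ g b) := by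
  obtain ⟨c, rfl⟩ := Nat.exists_eq_add_of_le hab
  rw [g_add f g M hg, List.append_assoc]
  exact (Dom.refl _).app (swap_lift f g M hf hM hg a c)

theorem shift_dom (f g : ℕ → List ℕ) (M : ℕ)
    (hf : ∀ a b, a ≤ b → Dom (f b ++ f a) (f a ++ f b)) (hM : ∀ j, ∀ x ∈ f j, x ≤ M)
    (hg : ∀ k, g k = [M] ++ (List.range' 1 k).flatMap f) (k c : ℕ) :
    Dom ((List.range' (k+1) c).flatMap g)
      ((List.range' k c).flatMap g ++ (List.range' (k+1) c).flatMap f) := by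
  induction c with
  | zero => simpa using Dom.refl _
  | succ c ih =>
    have e1 : g (k + 1 + c) = g (k + c) ++ f (k + c + 1) := by
      have := g_add f g M hg (k + c) 1
      rw [show k + 1 + c = k + c + 1 by omega, this]; simp
    have sw : Dom ((List.range' (k+1) c).flatMap f ++ g (k + c))
        (g (k + c) ++ (List.range' (k+1) c).flatMap f) := by
      have h1 := swap_lift f g M hf hM hg k c
      rw [g_add f g M hg, ← List.append_assoc]
      exact h1.app (Dom.refl _)
    have h1 := ih.app (Dom.refl (g (k + c) ++ f (k + c + 1)))
    have h2 := ((Dom.refl ((List.range' k c).flatMap g)).app sw).app (Dom.refl (f (k + c + 1)))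
    simp only [List.range'_1_concat, List.flatMap_append, List.flatMap_cons, List.flatMap_nil,
      List.append_nil, e1]
    rw [show k + 1 + c = k + c + 1 by omega]
    simp only [List.append_assoc] at *
    exact h1.trans h2

/-! monomial lists -/

def DL : (n : ℕ) → ℕ → List (Fin n → ℕ)
  | 0, t => if t = 0 then [Fin.elim0] else []
  | n + 1, t => (List.range (t + 1)).flatMap fun j =>
      (DL n j).map (fun m => (Fin.cons (t - j) m : Fin (n + 1) → ℕ))

def wt {n : ℕ} (m : Fin n → ℕ) : ℕ := (univ.filter fun j : Fin n => ∀ i, j < i → m i = 0).card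

def wR {n : ℕ} (a : ℕ) (m : Fin n → ℕ) : ℕ :=
  (univ.filter fun j : Fin n => (∀ i, j < i → m i = 0) ∧ x1exp (m + Pi.single j 1) < a).card

def W (n j : ℕ) : List ℕ := (DL n j).map wt

theorem mem_DL {n t : ℕ} {m : Fin n → ℕ} : m ∈ DL n t ↔ ∑ i, m i = t := by
  induction n generalizing t with
  | zero =>
    by_cases h : t = 0
    · simp [DL, h]; exact Subsingleton.elim _ _
    · simp [DL, h]; omega
  | succ n ih =>
    simp only [DL, List.mem_flatMap, List.mem_range, List.mem_map, ih, Fin.sum_univ_succ]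
    constructor
    · rintro ⟨j, hj, m', hm', rfl⟩
      simp [hm']; omega
    · intro h
      refine ⟨∑ i : Fin n, m i.succ, by omega, Fin.tail m, rfl, ?_⟩
      rw [show t - ∑ i : Fin n, m i.succ = m 0 by omega]
      exact Fin.cons_self_tail m

theorem lexLt_cons_lt {n : ℕ} {c c' : ℕ} (u v : Fin n → ℕ) (h : c < c') :
    lexLt (Fin.cons c u : Fin (n+1) → ℕ) (Fin.cons c' v) :=
  ⟨0, by simp, by simpa using h⟩

theorem lexLt_cons {n : ℕ} {c : ℕ} {u v : Fin n → ℕ} (h : lexLt u v) :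
    lexLt (Fin.cons c u : Fin (n+1) → ℕ) (Fin.cons c v) := by
  obtain ⟨i, h1, h2⟩ := h
  refine ⟨i.succ, ?_, by simpa using h2⟩
  intro j hj
  induction j using Fin.cases with
  | zero => simp
  | succ j => simpa using h1 j (by simpa using hj)

theorem DL_sorted (n t : ℕ) : (DL n t).Pairwise (fun u v => lexLt v u) := by
  induction n generalizing t with
  | zero => by_cases h : t = 0 <;> simp [DL, h]
  | succ n ih =>
    rw [DL, List.pairwise_flatMap]
    constructor
    · intro j _
      rw [List.pairwise_map]
      exact (ih j).imp fun h => lexLt_cons h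
    · have := List.pairwise_lt_range (n := t + 1)
      refine this.imp_of_mem ?_
      intro i j hi hj hij x hx y hy
      simp only [List.mem_map, List.mem_range] at *
      obtain ⟨u, -, rfl⟩ := hx
      obtain ⟨v, -, rfl⟩ := hy
      exact lexLt_cons_lt _ _ (by omega)

theorem lexLt_irrefl {n : ℕ} (u : Fin n → ℕ) : ¬ lexLt u u := by
  rintro ⟨i, -, h⟩; exact lt_irrefl _ h

theorem lexLt_asymm {n : ℕ} {u v : Fin n → ℕ} (h : lexLt u v) : ¬ lexLt v u := by
  rintro ⟨j, h1', h2'⟩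
  obtain ⟨i, h1, h2⟩ := h
  rcases lt_trichotomy i j with h | h | h
  · have := h1' i h; omega
  · subst h; omega
  · have := h1 j h; omega

theorem lexSeg_eq {n : ℕ} (l : List (Fin n → ℕ)) (hl : l.Pairwise (fun u v => lexLt v u)) (d : ℕ) :
    lexSeg l.toFinset d = (l.take d).toFinset := by
  have hnd : l.Nodup := by
    rw [List.nodup_iff_pairwise_ne]
    refine hl.imp ?_
    intro a b h e
    rw [e] at h
    exact lexLt_irrefl b h
  have key : ∀ i (hi : i < l.length),
      (l.toFinset.filter (fun v => l[i] = v ∨ lexLt l[i] v)) = (l.take (i+1)).toFinset := by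
    intro i hi
    rw [List.pairwise_iff_getElem] at hl
    ext v
    simp only [mem_filter, List.mem_toFinset, List.mem_take_iff_getElem]
    constructor
    · rintro ⟨hv, h⟩
      obtain ⟨k, hk, rfl⟩ := List.getElem_of_mem hv
      refine ⟨k, ?_, rfl⟩
      by_contra hc
      have hik : i < k := by omega
      rcases h with h | h
      · have := hl i k hi hk hik
        rw [h] at this
        exact lexLt_irrefl _ this
      · exact lexLt_asymm h (hl i k hi hk hik)
    · rintro ⟨k, hk, rfl⟩
      refine ⟨List.getElem_mem _, ?_⟩
      rcases Nat.lt_or_ge k i with h | h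
      · exact Or.inr (hl k i _ hi h)
      · have : k = i := by omega
        subst this; exact Or.inl rfl
  ext m
  simp only [lexSeg, mem_filter, List.mem_toFinset]
  constructor
  · rintro ⟨hm, h⟩
    obtain ⟨i, hi, rfl⟩ := List.getElem_of_mem hm
    rw [key i hi, List.toFinset_card_of_nodup (hnd.sublist (List.take_sublist _ _))] at h
    rw [List.mem_take_iff_getElem]
    refine ⟨i, ?_, rfl⟩
    rw [List.length_take] at h
    omega
  · intro hm
    rw [List.mem_take_iff_getElem] at hm
    obtain ⟨i, hi, rfl⟩ := hm
    refine ⟨List.getElem_mem _, ?_⟩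
    rw [key i (by omega), List.toFinset_card_of_nodup (hnd.sublist (List.take_sublist _ _)),
      List.length_take]
    omega

theorem RMon_eq (n a t : ℕ) :
    RMon n a t = ((DL n t).filter (fun m => decide (x1exp m < a))).toFinset := by
  ext m
  simp [RMon, degMon, mem_DL, Finset.Nat.mem_antidiagonalTuple]

theorem x1exp_mono {n : ℕ} {u v : Fin n → ℕ} (h : ∀ i, u i ≤ v i) : x1exp u ≤ x1exp v := by
  unfold x1exp; split_ifs
  · exact h _
  · exact le_rfl

theorem R1mul_eq {n a t : ℕ} (L : Finset (Fin n → ℕ)) (hL : IsLexSeg (RMon n a t) L) :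
    R1mul n a L = L.biUnion (fun m => (univ.filter fun j : Fin n => (∀ i, j < i → m i = 0) ∧
      x1exp (m + Pi.single j 1) < a).image (fun j => m + Pi.single j 1)) := by
  ext p
  simp only [R1mul, S1mul, mem_filter, mem_biUnion, mem_univ, true_and, mem_image]
  constructor
  · rintro ⟨⟨i, m, hm, rfl⟩, ha⟩
    by_cases hc : ∀ k, i < k → m k = 0
    · exact ⟨m, hm, i, ⟨hc, ha⟩, rfl⟩
    push Not at hc
    obtain ⟨k0, hk0, hk0'⟩ := hc
    -- the maximal index
    have hne : (univ.filter fun k : Fin n => m k ≠ 0).Nonempty := ⟨k0, by simpa using hk0'⟩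
    obtain ⟨j, hj, hmax⟩ := Finset.exists_max_image _ id hne
    simp only [mem_filter, mem_univ, true_and, id] at hj hmax
    have hij : i < j := lt_of_lt_of_le hk0 (hmax k0 hk0')
    let m' : Fin n → ℕ := fun k => (m + Pi.single i 1 : Fin n → ℕ) k - (Pi.single j 1 : Fin n → ℕ) k
    have hadd : m' + Pi.single j 1 = m + Pi.single i 1 := by
      funext k
      simp only [m', Pi.add_apply]
      by_cases hk : k = j
      · subst hk; simp; omega
      · simp [Pi.single_eq_of_ne hk]
    have hmR := hL.1 hm
    have hm'R : m' ∈ RMon n a t := by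
      simp only [RMon, mem_filter, degMon, Finset.Nat.mem_antidiagonalTuple] at hmR ⊢
      constructor
      · have := congrArg (fun u : Fin n → ℕ => ∑ k, u k) hadd
        simp only [Pi.add_apply, Finset.sum_add_distrib, Finset.sum_pi_single', mem_univ,
          if_true] at this
        omega
      · exact lt_of_le_of_lt (x1exp_mono fun k => Nat.sub_le _ _) ha
    have hlex : lexLt m m' := by
      refine ⟨i, ?_, ?_⟩
      · intro k hk
        simp [m', Pi.single_eq_of_ne hk.ne, Pi.single_eq_of_ne (hk.trans hij).ne]
      · simp [m', Pi.single_eq_of_ne hij.ne]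
    refine ⟨m', hL.2 m hm m' hm'R hlex, j, ⟨?_, by rw [hadd]; exact ha⟩, hadd⟩
    intro k hk
    have : m k = 0 := by
      by_contra h
      exact absurd (hmax k h) (not_le.2 hk)
    simp [m', this, Pi.single_eq_of_ne (hij.trans hk).ne']
  · rintro ⟨m, hm, j, ⟨h1, h2⟩, rfl⟩
    exact ⟨⟨j, m, hm, rfl⟩, h2⟩

theorem R1mul_card {n a t : ℕ} (L : Finset (Fin n → ℕ)) (hL : IsLexSeg (RMon n a t) L) :
    (R1mul n a L).card = ∑ m ∈ L, wR a m := by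
  rw [R1mul_eq L hL, Finset.card_biUnion]
  · refine Finset.sum_congr rfl fun m _ => ?_
    rw [Finset.card_image_of_injective]
    · rfl
    · intro j j' h
      have h := congrFun (add_left_cancel h) j
      by_contra hne
      simp [Pi.single_eq_of_ne hne] at h
  · intro u _ v _ huv
    rw [Function.onFun, Finset.disjoint_left]
    intro p hp hq
    simp only [mem_image, mem_filter, mem_univ, true_and] at hp hq
    obtain ⟨j, ⟨hj, -⟩, rfl⟩ := hp
    obtain ⟨k, ⟨hk, -⟩, h⟩ := hq
    apply huv
    have : j = k := by
      rcases lt_trichotomy j k with h' | h' | h'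
      · have := congrFun h k
        simp [Pi.single_eq_of_ne h'.ne', hj k h'] at this
      · exact h'
      · have := congrFun h j
        simp [Pi.single_eq_of_ne h'.ne', hk j h'] at this
    subst this
    exact (add_right_cancel h).symm

theorem lexSeg_isLexSeg {n : ℕ} (l : List (Fin n → ℕ)) (hl : l.Pairwise (fun u v => lexLt v u))
    (d : ℕ) : IsLexSeg l.toFinset (lexSeg l.toFinset d) := by
  refine ⟨Finset.filter_subset _ _, ?_⟩
  intro m hm v hv hlt
  rw [lexSeg_eq l hl, List.mem_toFinset, List.mem_take_iff_getElem] at *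
  obtain ⟨i, hi, rfl⟩ := hm
  obtain ⟨k, hk, rfl⟩ := List.getElem_of_mem hv
  refine ⟨k, ?_, rfl⟩
  by_contra hc
  rw [List.pairwise_iff_getElem] at hl
  exact lexLt_asymm hlt (hl i k _ hk (by omega))

def RL (n a t : ℕ) : List (Fin n → ℕ) := (DL n t).filter (fun m => decide (x1exp m < a))

theorem RL_sorted (n a t : ℕ) : (RL n a t).Pairwise (fun u v => lexLt v u) :=
  (DL_sorted n t).filter _

theorem nodup_of_sorted {n : ℕ} {l : List (Fin n → ℕ)} (hl : l.Pairwise (fun u v => lexLt v u)) :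
    l.Nodup := by
  rw [List.nodup_iff_pairwise_ne]
  refine hl.imp ?_
  intro a b h e
  rw [e] at h
  exact lexLt_irrefl b h

theorem dnt_eq (n a t d : ℕ) : dnt n a t d = (((RL n a t).map (wR a)).take d).sum := by
  have hl := RL_sorted n a t
  have e : RMon n a t = (RL n a t).toFinset := RMon_eq n a t
  have h := lexSeg_isLexSeg _ hl d
  rw [← e] at h
  rw [dnt, R1mul_card _ h, e, lexSeg_eq _ hl, List.sum_toFinset, List.map_take]
  exact (nodup_of_sorted hl).sublist (List.take_sublist _ _)

theorem RMon_card (n a t : ℕ) : (RMon n a t).card = (RL n a t).length := by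
  rw [RMon_eq, ← RL, List.toFinset_card_of_nodup (nodup_of_sorted (RL_sorted n a t))]

theorem wt_le {n : ℕ} (m : Fin n → ℕ) : wt m ≤ n := by
  unfold wt
  exact (Finset.card_filter_le _ _).trans (by simp)

theorem W_le (n j x : ℕ) (hx : x ∈ W n j) : x ≤ n := by
  simp only [W, List.mem_map] at hx
  obtain ⟨m, -, rfl⟩ := hx
  exact wt_le m

theorem wt_cons {n : ℕ} (c : ℕ) (m : Fin n → ℕ) (hm : ∑ i, m i ≠ 0) :
    wt (Fin.cons c m : Fin (n+1) → ℕ) = wt m := by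
  have h0 : ¬ ∀ i, m i = 0 := fun h => hm (by simp [h])
  unfold wt
  rw [← Finset.card_map (Fin.succEmb n)]
  congr 1
  ext j
  induction j using Fin.cases with
  | zero => simpa [Fin.forall_fin_succ] using h0
  | succ j => simp [Fin.forall_fin_succ]

theorem wR_cons {n : ℕ} (a c : ℕ) (m : Fin n → ℕ) (hc : c < a) (h : ∑ i, m i = 0 → c + 1 = a) :
    wR a (Fin.cons c m : Fin (n+1) → ℕ) = wt m := by
  unfold wt wR
  rw [← Finset.card_map (Fin.succEmb n)]
  congr 1
  ext j
  induction j using Fin.cases with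
  | zero =>
    simp [Fin.forall_fin_succ, x1exp]
    intro h'
    have := h (by simp [h'])
    omega
  | succ j => simp [Fin.forall_fin_succ, x1exp, hc]

theorem W_zero (n : ℕ) : W n 0 = [n] := by
  have : DL n 0 = [0] := by
    induction n with
    | zero => simp [DL]; exact Subsingleton.elim _ _
    | succ n ih => simp [DL, ih]; funext i; induction i using Fin.cases <;> simp
  simp [W, this, wt]

theorem W_succ (n k : ℕ) : W (n+1) k = [n+1] ++ (List.range' 1 k).flatMap (W n) := by
  cases k with
  | zero => simp [W_zero]
  | succ k =>
  have : DL (n+1) (k+1) = (Fin.cons (k+1) 0 : Fin (n+1) → ℕ) ::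
      (List.range' 1 (k+1)).flatMap fun j =>
      (DL n j).map (fun m => (Fin.cons (k + 1 - j) m : Fin (n + 1) → ℕ)) := by
    have hz : DL n 0 = [0] := by
      induction n with
      | zero => simp [DL]; exact Subsingleton.elim _ _
      | succ n ih => simp [DL, ih]; funext i; induction i using Fin.cases <;> simp
    rw [DL, List.range_eq_range', List.range'_succ, List.flatMap_cons, hz]
    rfl
  rw [W, this, List.map_cons, List.map_flatMap, List.singleton_append]
  congr 1
  · simp [wt, Fin.forall_fin_succ]
  · apply List.flatMap_congr
    intro j hj
    rw [W, List.map_map]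
    apply List.map_congr_left
    intro m hm
    rw [mem_DL] at hm
    simp only [List.mem_range'_1] at hj
    exact wt_cons _ _ (by omega)

theorem W_swap (n : ℕ) : ∀ a b, a ≤ b → Dom (W n b ++ W n a) (W n a ++ W n b) := by
  induction n with
  | zero =>
    intro a b h
    rcases h.eq_or_lt with rfl | h
    · exact Dom.refl _
    · have : W 0 b = [] := by simp [W, DL, show b ≠ 0 by omega]
      simpa [this] using Dom.refl _
  | succ n ih =>
    exact swap_next (W n) (W (n+1)) (n+1) ih (fun j x hx => (W_le n j x hx).trans (by omega)) (W_succ n)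

theorem RL_wt (n a t : ℕ) (ha : 1 ≤ a) (h : a ≤ t + 1) :
    (RL (n+1) a t).map (wR a) = (List.range' (t+1-a) a).flatMap (W n) := by
  have e : RL (n+1) a t = (List.range' (t+1-a) a).flatMap fun j =>
      (DL n j).map (fun m => (Fin.cons (t - j) m : Fin (n + 1) → ℕ)) := by
    rw [RL, DL, List.range_eq_range',
      show List.range' 0 (t+1) = List.range' 0 (t+1-a) ++ List.range' (t+1-a) a by
        have := List.range'_append_1 (s := 0) (m := t+1-a) (n := a)
        rw [Nat.zero_add] at this
        rw [this]; congr 1; omega,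
      List.flatMap_append, List.filter_append]
    rw [List.filter_eq_nil_iff.2, List.nil_append, List.filter_eq_self.2]
    · intro m hm
      simp only [List.mem_flatMap, List.mem_map, List.mem_range'_1] at hm
      obtain ⟨j, hj, m', -, rfl⟩ := hm
      simp [x1exp]; omega
    · intro m hm
      simp only [List.mem_flatMap, List.mem_map, List.mem_range'_1] at hm
      obtain ⟨j, hj, m', -, rfl⟩ := hm
      simp [x1exp]; omega
  rw [e, List.map_flatMap]
  apply List.flatMap_congr
  intro j hj
  rw [W, List.map_map]
  apply List.map_congr_left
  intro m hm
  rw [mem_DL] at hm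
  simp only [List.mem_range'_1] at hj
  exact wR_cons _ _ _ (by omega) (by omega)

theorem wR_le {n : ℕ} (a : ℕ) (m : Fin n → ℕ) : wR a m ≤ wt m := by
  refine Finset.card_le_card fun j hj => ?_
  simp only [mem_filter] at *
  exact ⟨hj.1, hj.2.1⟩

theorem x1exp_le {n : ℕ} (m : Fin n → ℕ) : x1exp m ≤ ∑ i, m i := by
  unfold x1exp; split_ifs
  · exact Finset.single_le_sum (f := m) (fun _ _ => Nat.zero_le _) (mem_univ _)
  · exact Nat.zero_le _

theorem RL_all (n a t : ℕ) (h : t < a) : RL n a t = DL n t := by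
  rw [RL, List.filter_eq_self]
  intro m hm
  rw [mem_DL] at hm
  have := x1exp_le m
  simp; omega

theorem wR_eq {n : ℕ} (a t : ℕ) (h : t + 1 < a) (m : Fin n → ℕ) (hm : ∑ i, m i = t) :
    wR a m = wt m := by
  unfold wR wt
  congr 1
  ext j
  have := x1exp_le (m + Pi.single j 1)
  simp only [Pi.add_apply, Finset.sum_add_distrib, Finset.sum_pi_single', mem_univ, if_true, hm]
    at this
  simp only [mem_filter, mem_univ, true_and, and_iff_left_iff_imp]
  intro _; omega

/-- For positive integers `d, n, t` with `n ≥ 2`, and `d` smaller than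
the number of monomials in `R_t` (hence also in `R_{t+1}`), `d_{n,t+1} ≤ d_{n,t}`. -/
theorem stmt_13 (n a t d : ℕ) (hn : 2 ≤ n) (ha : 1 ≤ a) (ht : 1 ≤ t) (hd0 : 1 ≤ d)
    (hd : d < (RMon n a t).card) :
    dnt n a (t + 1) d ≤ dnt n a t d := by
  obtain ⟨n, rfl⟩ := Nat.exists_eq_add_of_le' hn
  rw [RMon_card] at hd
  rw [dnt_eq, dnt_eq]
  by_cases h : a ≤ t + 1
  · have hlen : d ≤ ((List.range' (t+1-a) a).flatMap (W (n+1))).length := by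
      rw [← RL_wt (n+1) a t ha h, List.length_map]; exact hd.le
    rw [RL_wt (n+1) a t ha h, RL_wt (n+1) a (t+1) ha (by omega)]
    have := (shift_dom (W n) (W (n+1)) (n+1) (W_swap n)
      (fun j x hx => (W_le n j x hx).trans (by omega)) (W_succ n) (t+1-a) a).2 d
    rw [List.take_append_of_le_length hlen] at this
    rw [show t + 1 + 1 - a = t + 1 - a + 1 by omega]
    exact this
  · push Not at h
    rw [RL_all _ _ _ h, RL_all _ _ _ (by omega : t < a)]
    rw [RL_all _ _ _ (by omega : t < a)] at hd
    have e1 : (DL (n+2) t).map (wR a) = W (n+2) t :=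
      List.map_congr_left fun m hm => wR_eq a t h m (mem_DL.1 hm)
    have e2 : (((DL (n+2) (t+1)).map (wR a)).take d).sum ≤ ((W (n+2) (t+1)).take d).sum := by
      rw [W, ← List.map_take, ← List.map_take]
      exact List.sum_le_sum fun m _ => wR_le a m
    rw [e1]
    refine e2.trans ?_
    rw [g_add (W (n+1)) (W (n+2)) (n+2) (W_succ (n+1)) t 1, List.take_append_of_le_length]
    rw [W, List.length_map]; exact hd.le
end
end

section
/- Let n ≥ 3 and let d be a positive integer. Then for all sufficiently large integers t', one has d_{n,t'} = d^{<n−2>}. -/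
open scoped Classical
open Finset

noncomputable section

def emb14 (k b c : ℕ) (u : Fin (k+1) → ℕ) : Fin (k+2) → ℕ :=
  Fin.cons b (u + Pi.single 0 c)

lemma emb14_inj (k b c : ℕ) : Function.Injective (emb14 k b c) := by
  intro u v h
  have := Fin.cons_injective2 h
  exact add_right_cancel this.2

lemma emb14_lex (k b c : ℕ) (u v : Fin (k+1) → ℕ) :
    lexLt (emb14 k b c u) (emb14 k b c v) ↔ lexLt u v := by
  constructor
  · rintro ⟨i, h1, h2⟩
    induction i using Fin.cases with
    | zero => simp [emb14] at h2
    | succ i =>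
      refine ⟨i, fun j hj => ?_, ?_⟩
      · have := h1 j.succ (Fin.succ_lt_succ_iff.2 hj)
        simpa [emb14] using this
      · simpa [emb14] using h2
  · rintro ⟨i, h1, h2⟩
    refine ⟨i.succ, fun j hj => ?_, ?_⟩
    · induction j using Fin.cases with
      | zero => simp [emb14]
      | succ j =>
        have := h1 j (Fin.succ_lt_succ_iff.1 hj)
        simpa [emb14] using this
    · simpa [emb14] using h2

lemma emb14_mem (k b c d : ℕ) (u : Fin (k+1) → ℕ) (hu : u ∈ degMon (k+1) d) :
    emb14 k b c u ∈ RMon (k+2) (b+1) (b + c + d) := by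
  simp only [RMon, degMon, mem_filter, Finset.Nat.mem_antidiagonalTuple] at *
  constructor
  · rw [Fin.sum_univ_succ]
    simp [emb14, Finset.sum_add_distrib, hu]
    omega
  · simp [x1exp, emb14]

lemma emb14_top (k b c d : ℕ) (m : Fin (k+2) → ℕ) (hm : m ∈ RMon (k+2) (b+1) (b + c + d))
    (hn : ¬ ∃ u ∈ degMon (k+1) d, emb14 k b c u = m) (u : Fin (k+1) → ℕ) :
    lexLt m (emb14 k b c u) := by
  simp only [RMon, degMon, mem_filter, Finset.Nat.mem_antidiagonalTuple] at *
  obtain ⟨h1, h2⟩ := hm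
  simp only [x1exp, Nat.zero_lt_succ, dite_true] at h2
  change m 0 < b + 1 at h2
  rcases Nat.lt_or_ge (m 0) b with h | h
  · exact ⟨0, fun j hj => absurd hj (Fin.not_lt_zero j), by simpa [emb14] using h⟩
  have hb : m 0 = b := by omega
  rcases Nat.lt_or_ge (m 1) c with h3 | h3
  · refine ⟨Fin.succ 0, fun j hj => ?_, ?_⟩
    · induction j using Fin.cases with
      | zero => simpa [emb14] using hb
      | succ j => exact absurd (Fin.succ_lt_succ_iff.1 hj) (Fin.not_lt_zero j)
    · have : m (Fin.succ 0) < u 0 + c := by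
        change m 1 < _
        omega
      simpa [emb14] using this
  exfalso
  apply hn
  have key : (Fin.tail m - Pi.single 0 c) + Pi.single 0 c = Fin.tail m := by
    funext j
    induction j using Fin.cases with
    | zero =>
      have : Fin.tail m 0 = m 1 := rfl
      simp [this]
      omega
    | succ j => simp
  refine ⟨Fin.tail m - Pi.single 0 c, ?_, ?_⟩
  · have h4 : ∑ i, (Fin.tail m) i = c + d := by
      rw [Fin.sum_univ_succ] at h1
      simp only [Fin.tail]
      omega
    rw [← key] at h4
    simp only [Pi.add_apply, Finset.sum_add_distrib] at h4
    have h5 : ∑ i : Fin (k+1), (Pi.single 0 c : Fin (k+1) → ℕ) i = c := by simp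
    omega
  · rw [emb14, key, ← hb, Fin.cons_self_tail]

lemma lexLt14_asymm {n : ℕ} {u v : Fin n → ℕ} (h : lexLt u v) (h' : lexLt v u ∨ v = u) : False := by
  obtain ⟨i, h1, h2⟩ := h
  rcases h' with ⟨j, h3, h4⟩ | h'
  · rcases lt_trichotomy i j with h | h | h
    · have := h3 i h; omega
    · subst h; omega
    · have := h1 j h; omega
  · subst h'; omega

lemma card14 (k d : ℕ) (hk : 1 ≤ k) : d + 1 ≤ (degMon (k+1) d).card := by
  obtain ⟨k, rfl⟩ : ∃ l, k = l + 1 := ⟨k-1, by omega⟩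
  have : (Finset.range (d+1)).card ≤ (degMon (k+1+1) d).card := by
    apply Finset.card_le_card_of_injOn (fun j : ℕ => (Fin.cons j (Fin.cons (d - j) (0 : Fin k → ℕ) : Fin (k+1) → ℕ) : Fin (k+1+1) → ℕ))
    · intro j hj
      simp at hj
      simp [degMon, Finset.Nat.mem_antidiagonalTuple, Fin.sum_univ_succ]
      omega
    · intro i _ j _ h
      exact (Fin.cons_injective2 h).1
  simpa using this

lemma lexSeg14 (k b c d : ℕ) (hk : 1 ≤ k) :
    lexSeg (RMon (k+2) (b+1) (b+c+d)) d = (lexSeg (degMon (k+1) d) d).image (emb14 k b c) := by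
  have up : ∀ u ∈ degMon (k+1) d,
      (RMon (k+2) (b+1) (b+c+d)).filter (fun v => emb14 k b c u = v ∨ lexLt (emb14 k b c u) v)
      = ((degMon (k+1) d).filter (fun v => u = v ∨ lexLt u v)).image (emb14 k b c) := by
    intro u hu
    ext v
    simp only [mem_filter, mem_image]
    constructor
    · rintro ⟨hv, h⟩
      by_cases hn : ∃ w ∈ degMon (k+1) d, emb14 k b c w = v
      · obtain ⟨w, hw, rfl⟩ := hn
        rw [emb14_lex, (emb14_inj k b c).eq_iff] at h
        exact ⟨w, ⟨hw, h⟩, rfl⟩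
      · exact (lexLt14_asymm (emb14_top k b c d v hv hn u) h.symm).elim
    · rintro ⟨w, ⟨hw, h⟩, rfl⟩
      rw [emb14_lex, (emb14_inj k b c).eq_iff]
      exact ⟨emb14_mem _ _ _ _ _ hw, h⟩
  ext m
  simp only [lexSeg, mem_filter, mem_image]
  constructor
  · rintro ⟨hm, h⟩
    by_cases hn : ∃ w ∈ degMon (k+1) d, emb14 k b c w = m
    · obtain ⟨w, hw, rfl⟩ := hn
      rw [up w hw, Finset.card_image_of_injective _ (emb14_inj k b c)] at h
      exact ⟨w, ⟨hw, h⟩, rfl⟩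
    · exfalso
      have h1 : ((degMon (k+1) d).image (emb14 k b c)).card ≤ _ := Finset.card_le_card
        (t := (RMon (k+2) (b+1) (b+c+d)).filter (fun v => m = v ∨ lexLt m v)) (by
          intro v hv
          obtain ⟨w, hw, rfl⟩ := mem_image.1 hv
          exact mem_filter.2 ⟨emb14_mem _ _ _ _ _ hw, Or.inr (emb14_top k b c d m hm hn w)⟩)
      rw [Finset.card_image_of_injective _ (emb14_inj k b c)] at h1
      have := card14 k d hk
      omega
  · rintro ⟨w, ⟨hw, h⟩, rfl⟩
    rw [up w hw, Finset.card_image_of_injective _ (emb14_inj k b c)]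
    exact ⟨emb14_mem _ _ _ _ _ hw, h⟩

lemma emb14_add (k b c : ℕ) (u : Fin (k+1) → ℕ) (i : Fin (k+1)) :
    emb14 k b c u + Pi.single i.succ 1 = emb14 k b c (u + Pi.single i 1) := by
  funext j
  induction j using Fin.cases with
  | zero => simp [emb14, Pi.single_apply, (Fin.succ_ne_zero i).symm]
  | succ j => simp [emb14, Pi.single_apply]; omega

lemma R1mul14 (k b c : ℕ) (L : Finset (Fin (k+1) → ℕ)) :
    R1mul (k+2) (b+1) (L.image (emb14 k b c)) = (S1mul (k+1) L).image (emb14 k b c) := by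
  ext m
  simp only [R1mul, S1mul, mem_filter, mem_biUnion, mem_image, mem_univ, true_and]
  constructor
  · rintro ⟨⟨i, _, ⟨u, hu, rfl⟩, rfl⟩, h⟩
    induction i using Fin.cases with
    | zero => simp [x1exp, emb14] at h
    | succ i => exact ⟨_, ⟨i, u, hu, rfl⟩, (emb14_add k b c u i).symm⟩
  · rintro ⟨_, ⟨i, u, hu, rfl⟩, rfl⟩
    refine ⟨⟨i.succ, _, ⟨u, hu, rfl⟩, emb14_add k b c u i⟩, ?_⟩
    simp [x1exp, emb14]

/-- Let `n ≥ 3` and let `d` be a positive integer.  Then for all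
sufficiently large `t'`, `d_{n,t'} = d^{<n-2>}`. -/
theorem stmt_14 (n a d : ℕ) (hn : 3 ≤ n) (ha : 1 ≤ a) (hd0 : 1 ≤ d) :
    ∃ T : ℕ, ∀ t' : ℕ, T ≤ t' → dnt n a t' d = growth d (n - 2) := by
  obtain ⟨k, rfl⟩ : ∃ k, n = k + 2 := ⟨n - 2, by omega⟩
  obtain ⟨b, rfl⟩ : ∃ b, a = b + 1 := ⟨a - 1, by omega⟩
  refine ⟨b + d, fun t ht => ?_⟩
  obtain ⟨c, rfl⟩ : ∃ c, t = b + c + d := ⟨t - b - d, by omega⟩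
  rw [dnt, lexSeg14 k b c d (by omega), R1mul14,
    Finset.card_image_of_injective _ (emb14_inj k b c)]
  rfl
end
end

section
/- Let L_1 and L_2 be lexsegment sets in R_t of sizes b and c with b ≥ c, and let t' be a positive integer with b + c smaller than the number of monomials in R_{t+t'}. If there exist monomials m_1 and m_2 of degree t' in S' = F[x_2,...,x_n] such that m_1·L_1 and m_2·L_2 are disjoint and R_1·(m_1·L_1) ∩ R_1·(m_2·L_2) ≠ ∅, then b_{n,t} + c_{n,t} > (b+c)_{n,t+t'}. -/
open scoped Classical
open Finset

noncomputable section

theorem card_top_aux {α : Type*} [LinearOrder α] (G : Finset α) (d : ℕ) :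
    (G.filter (fun m => (G.filter (fun v => m ≤ v)).card ≤ d)).card = min d G.card := by
  classical
  induction G using Finset.induction_on_min with
  | empty => simp
  | insert x s hx ih =>
    have hxs : x ∉ s := fun h => lt_irrefl _ (hx x h)
    have h1 : (insert x s).filter (fun v => x ≤ v) = insert x s := by
      apply Finset.filter_true_of_mem
      intro v hv
      rcases Finset.mem_insert.1 hv with h | h
      · exact h.ge
      · exact (hx v h).le
    have h2 : ∀ m ∈ s, (insert x s).filter (fun v => m ≤ v) = s.filter (fun v => m ≤ v) := by
      intro m hm
      rw [Finset.filter_insert, if_neg (not_le.2 (hx m hm))]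
    have h3 : s.filter (fun m => ((insert x s).filter (fun v => m ≤ v)).card ≤ d)
        = s.filter (fun m => (s.filter (fun v => m ≤ v)).card ≤ d) := by
      apply Finset.filter_congr
      intro m hm
      rw [h2 m hm]
    rw [Finset.filter_insert, h1, h3, Finset.card_insert_of_notMem hxs]
    split_ifs with h
    · rw [Finset.card_insert_of_notMem (by simp [hxs]), ih]
      omega
    · rw [ih]
      omega

theorem card_lexSeg_aux {n : ℕ} (G : Finset (Fin n → ℕ)) (d : ℕ) (h : d ≤ G.card) :
    (lexSeg G d).card = d := by
  have hle : ∀ u v : Fin n → ℕ, (u = v ∨ lexLt u v) ↔ toLex u ≤ toLex v := by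
    intro u v
    rw [le_iff_eq_or_lt]
    exact or_congr (toLex_inj).symm Iff.rfl
  have key := card_top_aux (G.map (toLex (α := Fin n → ℕ)).toEmbedding) d
  rw [Finset.card_map, min_eq_left h] at key
  refine Eq.trans ?_ key
  rw [← Finset.card_map (toLex (α := Fin n → ℕ)).toEmbedding]
  congr 1
  ext m
  simp only [lexSeg, Finset.mem_map, Finset.mem_filter, Finset.filter_map, Finset.card_map, hle]
  constructor
  · rintro ⟨u, ⟨hu, hc⟩, rfl⟩
    refine ⟨u, ⟨hu, ?_⟩, rfl⟩
    simp only [Function.comp_def, Equiv.coe_toEmbedding] at hc ⊢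
    convert hc
  · rintro ⟨u, ⟨hu, hc⟩, rfl⟩
    refine ⟨u, ⟨hu, ?_⟩, rfl⟩
    simp only [Function.comp_def, Equiv.coe_toEmbedding] at hc ⊢
    convert hc

theorem x1exp_add_aux {n : ℕ} (u v : Fin n → ℕ) : x1exp (u + v) = x1exp u + x1exp v := by
  unfold x1exp
  split_ifs <;> simp

theorem mem_R1mul_aux {n a : ℕ} {M : Finset (Fin n → ℕ)} {w : Fin n → ℕ} :
    w ∈ R1mul n a M ↔ (∃ i, ∃ m ∈ M, m + Pi.single i 1 = w) ∧ x1exp w < a := by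
  simp [R1mul, S1mul]

theorem R1mul_mulMon_aux {n a : ℕ} (u : Fin n → ℕ) (hu : x1exp u = 0)
    (M : Finset (Fin n → ℕ)) : R1mul n a (mulMon u M) = mulMon u (R1mul n a M) := by
  ext w
  simp only [mulMon, mem_R1mul_aux, Finset.mem_image]
  constructor
  · rintro ⟨⟨i, _, ⟨m, hm, rfl⟩, rfl⟩, hw⟩
    refine ⟨m + Pi.single i 1, ⟨⟨i, m, hm, rfl⟩, ?_⟩, (add_assoc _ _ _).symm⟩
    rw [add_assoc, x1exp_add_aux, hu] at hw
    omega
  · rintro ⟨_, ⟨⟨i, m, hm, rfl⟩, hw⟩, rfl⟩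
    refine ⟨⟨i, u + m, ⟨m, hm, rfl⟩, add_assoc _ _ _⟩, ?_⟩
    rw [x1exp_add_aux, hu]
    omega

theorem card_mulMon_aux {n : ℕ} (u : Fin n → ℕ) (M : Finset (Fin n → ℕ)) :
    (mulMon u M).card = M.card :=
  Finset.card_image_of_injective _ (add_right_injective u)

theorem mulMon_sub_aux {n a t t' : ℕ} {u : Fin n → ℕ} (hu : u ∈ SpMon n t')
    {M : Finset (Fin n → ℕ)} (hM : M ⊆ RMon n a t) : mulMon u M ⊆ RMon n a (t + t') := by
  intro w hw
  obtain ⟨m, hm, rfl⟩ := Finset.mem_image.1 hw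
  have h := hM hm
  simp only [SpMon, RMon, degMon, Finset.mem_filter, Finset.Nat.mem_antidiagonalTuple] at *
  refine ⟨?_, ?_⟩
  · simp only [Pi.add_apply, Finset.sum_add_distrib]
    omega
  · rw [x1exp_add_aux]
    omega

/-- Let `L_1, L_2` be the lexsegment sets in `R_t` of sizes `b ≥ c`,
`t'` a positive integer with `b + c` smaller than the number of monomials in
`R_{t+t'}`.  (Lexsegment sets minimize growth in `R`: Clements–Lindström.)  If there
are degree-`t'` monomials `m_1, m_2` of `S' = F[x_2,...,x_n]` such that `m_1·L_1` and
`m_2·L_2` are disjoint while `R_1·(m_1·L_1) ∩ R_1·(m_2·L_2) ≠ ∅`, then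
`b_{n,t} + c_{n,t} > (b + c)_{n,t+t'}`. -/
theorem stmt_16 (n a t t' b c : ℕ) (ha : 1 ≤ a) (hcb : c ≤ b)
    (hb : b < (RMon n a t).card) (ht'0 : 1 ≤ t')
    (hsum : b + c < (RMon n a (t + t')).card)
    (hCL : ∀ (s : ℕ) (K : Finset (Fin n → ℕ)), K ⊆ RMon n a s →
      dnt n a s K.card ≤ (R1mul n a K).card)
    (L1 L2 : Finset (Fin n → ℕ))
    (hL1 : L1 = lexSeg (RMon n a t) b) (hL2 : L2 = lexSeg (RMon n a t) c)
    (m1 m2 : Fin n → ℕ) (hm1 : m1 ∈ SpMon n t') (hm2 : m2 ∈ SpMon n t')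
    (hdisj : Disjoint (mulMon m1 L1) (mulMon m2 L2))
    (hmeet : (R1mul n a (mulMon m1 L1) ∩ R1mul n a (mulMon m2 L2)).Nonempty) :
    dnt n a (t + t') (b + c) < dnt n a t b + dnt n a t c := by
  have hu1 : x1exp m1 = 0 := (Finset.mem_filter.1 hm1).2
  have hu2 : x1exp m2 = 0 := (Finset.mem_filter.1 hm2).2
  have hs1 : L1 ⊆ RMon n a t := hL1 ▸ Finset.filter_subset _ _
  have hs2 : L2 ⊆ RMon n a t := hL2 ▸ Finset.filter_subset _ _
  have hc1 : L1.card = b := by rw [hL1]; exact card_lexSeg_aux _ _ hb.le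
  have hc2 : L2.card = c := by rw [hL2]; exact card_lexSeg_aux _ _ (hcb.trans hb.le)
  have hK := hCL (t + t') (mulMon m1 L1 ∪ mulMon m2 L2)
    (Finset.union_subset (mulMon_sub_aux hm1 hs1) (mulMon_sub_aux hm2 hs2))
  rw [Finset.card_union_of_disjoint hdisj, card_mulMon_aux, card_mulMon_aux, hc1, hc2] at hK
  have hU : R1mul n a (mulMon m1 L1 ∪ mulMon m2 L2)
      = R1mul n a (mulMon m1 L1) ∪ R1mul n a (mulMon m2 L2) := by
    ext w
    simp only [mem_R1mul_aux, Finset.mem_union]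
    grind
  have hcard := Finset.card_union_add_card_inter (R1mul n a (mulMon m1 L1))
    (R1mul n a (mulMon m2 L2))
  have hpos := Finset.card_pos.2 hmeet
  have e1 : (R1mul n a (mulMon m1 L1)).card = dnt n a t b := by
    rw [R1mul_mulMon_aux m1 hu1, card_mulMon_aux, hL1, dnt]
  have e2 : (R1mul n a (mulMon m2 L2)).card = dnt n a t c := by
    rw [R1mul_mulMon_aux m2 hu2, card_mulMon_aux, hL2, dnt]
  rw [hU] at hK
  omega
end
end
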